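/- Let n ≥ 2, 0 < δ ≤ n, 0 ≤ κ < 1, and δ/n < p < δ. Then there exists a constant c depending only on n, δ, κ, and p such that for all f ∈ L¹_loc(ℝⁿ): ( ∫_{ℝⁿ} (I₁ f(x))^{p(δ−κp)/(δ−p)} dH^{δ−κp}_∞ )^{(δ−p)/(p(δ−κp))} ≤ c ( ∫_{ℝⁿ} |f(x)|^p dH^δ_∞ )^{1/p}, where I₁ f(x) := ∫_{ℝⁿ} |f(y)| / |x−y|^{n−1} dy is the Riesz potential of order 1. -/

import Mathlib

open MeasureTheory Metric Set Bornology
open scoped ENNReal NNReal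

/-- The `δ`-dimensional Hausdorff content of a set `E ⊆ ℝⁿ`, defined as the infimum of
`∑ᵢ rᵢ^δ` over all countable coverings of `E` by open balls `B(xᵢ, rᵢ)`. -/
noncomputable def hContent (n : ℕ) (δ : ℝ) (E : Set (EuclideanSpace ℝ (Fin n))) : ℝ≥0∞ :=
  ⨅ (x : ℕ → EuclideanSpace ℝ (Fin n)) (r : ℕ → ℝ≥0)
    (_ : E ⊆ ⋃ i, Metric.ball (x i) (r i)), ∑' i, (r i : ℝ≥0∞) ^ δ

/-- The `δ`-dimensional Hausdorff measure of `E ⊆ ℝⁿ`, obtained from coverings by open balls of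
radii at most `ρ`, in the limit `ρ → 0⁺` (equivalently: the supremum over `ρ > 0`, since the
infima increase as `ρ` decreases). -/
noncomputable def hMeasure (n : ℕ) (δ : ℝ) (E : Set (EuclideanSpace ℝ (Fin n))) : ℝ≥0∞ :=
  ⨆ (ρ : ℝ≥0) (_ : 0 < ρ),
    ⨅ (x : ℕ → EuclideanSpace ℝ (Fin n)) (r : ℕ → ℝ≥0)
      (_ : E ⊆ ⋃ i, Metric.ball (x i) (r i)) (_ : ∀ i, r i ≤ ρ), ∑' i, (r i : ℝ≥0∞) ^ δ

/-- The Choquet integral `∫_Ω f dH^δ_∞ = ∫₀^∞ H^δ_∞({x ∈ Ω : f x > t}) dt` of a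
(nonnegative) real-valued function with respect to the Hausdorff content. -/
noncomputable def choquet (n : ℕ) (δ : ℝ) (Ω : Set (EuclideanSpace ℝ (Fin n)))
    (f : EuclideanSpace ℝ (Fin n) → ℝ) : ℝ≥0∞ :=
  ∫⁻ t in Set.Ioi (0 : ℝ), hContent n δ {x ∈ Ω | t < f x}

/-- The Choquet integral of an `[0,∞]`-valued function with respect to the Hausdorff content. -/
noncomputable def echoquet (n : ℕ) (δ : ℝ) (Ω : Set (EuclideanSpace ℝ (Fin n)))
    (f : EuclideanSpace ℝ (Fin n) → ℝ≥0∞) : ℝ≥0∞ :=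
  ∫⁻ t in Set.Ioi (0 : ℝ), hContent n δ {x ∈ Ω | ENNReal.ofReal t < f x}

/-- The centered fractional Hardy–Littlewood maximal function
`M_κ f (x) = sup_{r>0} r^{κ-n} ∫_{B(x,r)} |f|`. -/
noncomputable def fracMaximal (n : ℕ) (κ : ℝ) (f : EuclideanSpace ℝ (Fin n) → ℝ)
    (x : EuclideanSpace ℝ (Fin n)) : ℝ≥0∞ :=
  ⨆ (r : ℝ) (_ : 0 < r),
    ENNReal.ofReal (r ^ (κ - n)) * ∫⁻ y in Metric.ball x r, ENNReal.ofReal |f y|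

/-- The Riesz potential of order `1`: `I₁ f (x) = ∫_{ℝⁿ} |f y| / |x-y|^{n-1} dy`. -/
noncomputable def rieszPot (n : ℕ) (f : EuclideanSpace ℝ (Fin n) → ℝ)
    (x : EuclideanSpace ℝ (Fin n)) : ℝ≥0∞ :=
  ∫⁻ y, ENNReal.ofReal |f y| / edist x y ^ ((n : ℝ) - 1)

/-- `Ω` is an `(α, β)`-John domain with John center `x₀`: every `x ∈ Ω` can be joined to `x₀`
by a rectifiable curve `γ : [0, L] → Ω` parametrized by arclength (hence `1`-Lipschitz) with
`γ 0 = x`, `γ L = x₀`, `L ≤ β` and `dist (γ t, ∂Ω) ≥ (α/β) t`. -/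
def IsJohnDomainWithCenter (n : ℕ) (α β : ℝ) (Ω : Set (EuclideanSpace ℝ (Fin n)))
    (x₀ : EuclideanSpace ℝ (Fin n)) : Prop :=
  x₀ ∈ Ω ∧ ∀ x ∈ Ω, ∃ L : ℝ, 0 ≤ L ∧ L ≤ β ∧ ∃ γ : ℝ → EuclideanSpace ℝ (Fin n),
    γ 0 = x ∧ γ L = x₀ ∧ (∀ t ∈ Set.Icc 0 L, γ t ∈ Ω) ∧
    LipschitzOnWith 1 γ (Set.Icc 0 L) ∧
    ∀ t ∈ Set.Icc 0 L, α / β * t ≤ Metric.infDist (γ t) (frontier Ω)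

/-- `Ω` is an `(α, β)`-John domain. -/
def IsJohnDomain (n : ℕ) (α β : ℝ) (Ω : Set (EuclideanSpace ℝ (Fin n))) : Prop :=
  ∃ x₀, IsJohnDomainWithCenter n α β Ω x₀

/-- The power `2 ^ x`, as an extended nonnegative real. -/
noncomputable def pow2 (x : ℝ) : ℝ≥0∞ := (2 : ℝ≥0∞) ^ x

lemma pow2_ne_zero (x : ℝ) : pow2 x ≠ 0 := by
  simp [pow2, ENNReal.rpow_eq_zero_iff]

lemma pow2_ne_top (x : ℝ) : pow2 x ≠ ∞ := by
  simp [pow2, ENNReal.rpow_eq_top_iff]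

lemma pow2_add (x y : ℝ) : pow2 (x + y) = pow2 x * pow2 y :=
  ENNReal.rpow_add x y (by simp) (by simp)

lemma pow2_zero : pow2 0 = 1 := by simp [pow2]

lemma pow2_rpow (x y : ℝ) : pow2 x ^ y = pow2 (x * y) := (ENNReal.rpow_mul _ _ _).symm

lemma pow2_mono {x y : ℝ} (h : x ≤ y) : pow2 x ≤ pow2 y :=
  ENNReal.rpow_le_rpow_of_exponent_le (by simp) h

lemma pow2_lt_pow2 {x y : ℝ} (h : x < y) : pow2 x < pow2 y :=
  ENNReal.rpow_lt_rpow_of_exponent_lt (by simp) (by simp) h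

lemma pow2_eq_ofReal (x : ℝ) : pow2 x = ENNReal.ofReal ((2 : ℝ) ^ x) := by
  rw [pow2, ← ENNReal.ofReal_rpow_of_pos two_pos]; simp

lemma pow2_intCast (k : ℤ) : pow2 k = ENNReal.ofReal ((2 : ℝ) ^ k) := by
  rw [pow2_eq_ofReal, Real.rpow_intCast]

lemma exists_eq_pow2 {a : ℝ≥0∞} (h0 : a ≠ 0) (ht : a ≠ ∞) : ∃ x : ℝ, a = pow2 x := by
  refine ⟨Real.logb 2 a.toReal, ?_⟩
  rw [pow2_eq_ofReal, Real.rpow_logb (by norm_num) (by norm_num) (ENNReal.toReal_pos h0 ht),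
    ENNReal.ofReal_toReal ht]

lemma exists_pow2_lt_le {a : ℝ≥0∞} (h0 : a ≠ 0) (ht : a ≠ ∞) :
    ∃ i : ℤ, pow2 i < a ∧ a ≤ pow2 (i + 1) := by
  obtain ⟨x, rfl⟩ := exists_eq_pow2 h0 ht
  refine ⟨⌈x⌉ - 1, pow2_lt_pow2 ?_, pow2_mono ?_⟩
  · push_cast; linarith [Int.ceil_lt_add_one x]
  · push_cast; linarith [Int.le_ceil x]

lemma tsum_pow2_nat_ne_top {a : ℝ} (ha : 0 < a) : ∑' i : ℕ, pow2 (-(i * a)) ≠ ∞ := by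
  have h : ∀ i : ℕ, pow2 (-(i * a)) = (pow2 (-a)) ^ i := fun i => by
    rw [← ENNReal.rpow_natCast, pow2_rpow]; ring_nf
  simp_rw [h, ENNReal.tsum_geometric]
  have : pow2 (-a) < 1 := pow2_zero ▸ pow2_lt_pow2 (by linarith)
  simpa [tsub_eq_zero_iff_le] using this

/-- Dyadic cubes of `ℝⁿ`: the pair `(k, m)` stands for the half-open cube with side `2 ^ k` and
corner `2 ^ k m`. -/
abbrev DyadicIndex (n : ℕ) := ℤ × (Fin n → ℤ)

/-- The position of the dyadic cube of side `2 ^ k` containing `x`. -/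
noncomputable def dyadicPos {n : ℕ} (k : ℤ) (x : EuclideanSpace ℝ (Fin n)) : Fin n → ℤ :=
  fun a => ⌊x a / (2 : ℝ) ^ k⌋

/-- The half-open dyadic cube with the given index. -/
def dyadicCube {n : ℕ} (R : DyadicIndex n) : Set (EuclideanSpace ℝ (Fin n)) :=
  {x | dyadicPos R.1 x = R.2}

/-- The `i`-th dyadic ancestor. -/
def ancestor {n : ℕ} (i : ℕ) (R : DyadicIndex n) : DyadicIndex n :=
  (R.1 + i, fun a => R.2 a / 2 ^ i)

/-- The offsets from a dyadic cube to its neighbours of the same size. -/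
noncomputable def neighbors (n : ℕ) : Finset (Fin n → ℤ) :=
  Fintype.piFinset fun _ => Finset.Icc (-1) 1

section
variable {n : ℕ}

lemma mem_neighbors {e : Fin n → ℤ} : e ∈ neighbors n ↔ ∀ a, -1 ≤ e a ∧ e a ≤ 1 := by
  simp [neighbors]

lemma ancestor_zero (R : DyadicIndex n) : ancestor 0 R = R := by
  simp [ancestor]

lemma ancestor_ancestor (i j : ℕ) (R : DyadicIndex n) :
    ancestor i (ancestor j R) = ancestor (j + i) R := by
  ext a
  · simp [ancestor, add_assoc]
  · simp only [ancestor]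
    rw [Int.ediv_ediv_of_nonneg (by positivity), pow_add]

lemma ancestor_injective (R : DyadicIndex n) : Function.Injective fun i => ancestor i R := by
  intro i j h
  have := congrArg Prod.fst h
  simpa [ancestor] using this

lemma dyadicPos_add (k : ℤ) (i : ℕ) (x : EuclideanSpace ℝ (Fin n)) (a : Fin n) :
    dyadicPos (k + i) x a = dyadicPos k x a / 2 ^ i := by
  have := Int.floor_div_natCast (x a / (2 : ℝ) ^ k) (2 ^ i)
  simp only [dyadicPos]
  rw [zpow_add₀ (by norm_num), zpow_natCast, ← div_div]
  exact_mod_cast this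

lemma ancestor_eq_of_mem {x : EuclideanSpace ℝ (Fin n)} {R : DyadicIndex n} (h : x ∈ dyadicCube R)
    (i : ℕ) : ancestor i R = (R.1 + i, dyadicPos (R.1 + i) x) := by
  ext a
  · rfl
  · simp only [ancestor, dyadicPos_add]
    rw [show dyadicPos R.1 x = R.2 from h]

lemma dyadicCube_eq_preimage (R : DyadicIndex n) :
    dyadicCube R = WithLp.ofLp ⁻¹' (univ.pi fun a =>
      Ico ((R.2 a : ℝ) * 2 ^ R.1) (((R.2 a : ℝ) + 1) * 2 ^ R.1)) := by
  ext x
  have h2 : (0 : ℝ) < 2 ^ R.1 := by positivity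
  simp only [dyadicCube, dyadicPos, Set.mem_ofPred_eq, funext_iff, mem_preimage, mem_pi, mem_univ,
    true_imp_iff, Int.floor_eq_iff, mem_Ico, le_div_iff₀ h2, div_lt_iff₀ h2]

lemma measurableSet_dyadicCube (R : DyadicIndex n) : MeasurableSet (dyadicCube R) := by
  rw [dyadicCube_eq_preimage]
  exact (MeasurableSet.univ_pi fun _ => measurableSet_Ico).preimage
    (PiLp.volume_preserving_ofLp _).measurable

lemma volume_dyadicCube (R : DyadicIndex n) : volume (dyadicCube R) = pow2 (R.1 * n) := by
  rw [dyadicCube_eq_preimage, (PiLp.volume_preserving_ofLp _).measure_preimage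
    (MeasurableSet.univ_pi fun _ => measurableSet_Ico).nullMeasurableSet, Real.volume_pi_Ico]
  have : ∀ a, ((R.2 a : ℝ) + 1) * 2 ^ R.1 - (R.2 a : ℝ) * 2 ^ R.1 = 2 ^ R.1 := fun a => by ring
  simp_rw [this, ← pow2_intCast]
  rw [Finset.prod_const, Finset.card_univ, Fintype.card_fin, ← ENNReal.rpow_natCast, pow2_rpow]

lemma exists_neighbor_of_dist_lt {k : ℤ} {x y : EuclideanSpace ℝ (Fin n)}
    (h : dist x y < 2 ^ k) : ∃ e ∈ neighbors n, y ∈ dyadicCube (k, dyadicPos k x + e) := by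
  refine ⟨dyadicPos k y - dyadicPos k x, ?_, by simp [dyadicCube]⟩
  rw [mem_neighbors]
  intro a
  have h2 : (0 : ℝ) < 2 ^ k := by positivity
  have h1 : |x a - y a| < 2 ^ k := by
    refine lt_of_le_of_lt ?_ h
    rw [dist_eq_norm]
    exact PiLp.norm_apply_le (x - y) a
  have h3 : |x a / 2 ^ k - y a / 2 ^ k| < 1 := by
    rw [← sub_div, abs_div, abs_of_pos h2, div_lt_one h2]; exact h1
  rw [abs_lt] at h3
  simp only [dyadicPos, Pi.sub_apply]
  have a1 := Int.floor_le (x a / 2 ^ k)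
  have a2 := Int.lt_floor_add_one (x a / 2 ^ k)
  have b1 := Int.floor_le (y a / 2 ^ k)
  have b2 := Int.lt_floor_add_one (y a / 2 ^ k)
  constructor
  · have : (⌊x a / 2 ^ k⌋ : ℝ) < (⌊y a / 2 ^ k⌋ : ℝ) + 2 := by linarith
    have : ⌊x a / 2 ^ k⌋ < ⌊y a / 2 ^ k⌋ + 2 := by exact_mod_cast this
    omega
  · have : (⌊y a / 2 ^ k⌋ : ℝ) < (⌊x a / 2 ^ k⌋ : ℝ) + 2 := by linarith
    have : ⌊y a / 2 ^ k⌋ < ⌊x a / 2 ^ k⌋ + 2 := by exact_mod_cast this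
    omega

lemma exists_neighbor_ancestor {e : Fin n → ℤ} (he : e ∈ neighbors n) (k : ℤ) (i : ℕ)
    (x : EuclideanSpace ℝ (Fin n)) : ∃ e' ∈ neighbors n,
      ancestor i (k, dyadicPos k x + e) = (k + i, dyadicPos (k + i) x + e') := by
  rw [mem_neighbors] at he
  refine ⟨fun a => (dyadicPos k x a + e a) / 2 ^ i - dyadicPos k x a / 2 ^ i, ?_, ?_⟩
  · rw [mem_neighbors]
    intro a
    have hp : (1 : ℤ) ≤ 2 ^ i := one_le_pow₀ (by norm_num)
    obtain ⟨h1, h2⟩ := he a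
    have u : (dyadicPos k x a + e a) / 2 ^ i ≤ (dyadicPos k x a + 1 * 2 ^ i) / 2 ^ i :=
      Int.ediv_le_ediv (by omega) (by omega)
    have l : (dyadicPos k x a + (-1) * 2 ^ i) / 2 ^ i ≤ (dyadicPos k x a + e a) / 2 ^ i :=
      Int.ediv_le_ediv (by omega) (by omega)
    rw [Int.add_mul_ediv_right _ _ (by omega)] at u l
    constructor <;> omega
  · ext a
    · rfl
    · simp [ancestor, dyadicPos_add]

/-- The corner of a dyadic cube. -/
noncomputable def dyadicCorner (R : DyadicIndex n) : EuclideanSpace ℝ (Fin n) :=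
  WithLp.toLp 2 fun a => (R.2 a : ℝ) * 2 ^ R.1

lemma mem_ball_dyadicCorner {e : Fin n → ℤ} (he : e ∈ neighbors n) (k : ℤ)
    (x : EuclideanSpace ℝ (Fin n)) :
    x ∈ ball (dyadicCorner (k, dyadicPos k x + e)) ((2 * n + 1) * 2 ^ k) := by
  rw [mem_neighbors] at he
  have h2 : (0 : ℝ) < 2 ^ k := by positivity
  rw [mem_ball, EuclideanSpace.dist_eq]
  have key : ∀ a, dist (x a) ((dyadicCorner (k, dyadicPos k x + e)) a) ^ 2
      ≤ (2 * 2 ^ k) ^ 2 := by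
    intro a
    refine pow_le_pow_left₀ dist_nonneg ?_ 2
    rw [Real.dist_eq]
    simp only [dyadicCorner, dyadicPos, Pi.add_apply]
    have a1 := Int.floor_le (x a / 2 ^ k)
    have a2 := Int.lt_floor_add_one (x a / 2 ^ k)
    rw [le_div_iff₀ h2] at a1
    rw [div_lt_iff₀ h2] at a2
    obtain ⟨e1, e2⟩ := he a
    have e1' : (-1 : ℝ) ≤ e a := by exact_mod_cast e1
    have e2' : (e a : ℝ) ≤ 1 := by exact_mod_cast e2
    push_cast
    rw [abs_le]
    constructor <;> nlinarith
  calc √(∑ a, dist (x a) ((dyadicCorner (k, dyadicPos k x + e)) a) ^ 2)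
      ≤ √(∑ a : Fin n, (2 * 2 ^ k) ^ 2) :=
        Real.sqrt_le_sqrt (Finset.sum_le_sum fun a _ => key a)
    _ ≤ √((n * (2 * 2 ^ k)) ^ 2) := by
        refine Real.sqrt_le_sqrt ?_
        rw [Finset.sum_const, Finset.card_univ, Fintype.card_fin, nsmul_eq_mul, mul_pow (n : ℝ)]
        gcongr
        exact_mod_cast Nat.le_self_pow (by norm_num) n
    _ = n * (2 * 2 ^ k) := Real.sqrt_sq (by positivity)
    _ < (2 * n + 1) * 2 ^ k := by nlinarith

end

/-- The sum of the weights of a dyadic cube and of all its ancestors. -/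
noncomputable def ancestorSum {n : ℕ} (c : DyadicIndex n → ℝ≥0∞) (R : DyadicIndex n) : ℝ≥0∞ :=
  ∑' i : ℕ, c (ancestor i R)

section
variable {n : ℕ}

lemma ancestorSum_eq_add (c : DyadicIndex n → ℝ≥0∞) (R : DyadicIndex n) :
    ancestorSum c R = c R + ancestorSum c (ancestor 1 R) := by
  unfold ancestorSum
  rw [tsum_eq_zero_add' ENNReal.summable]
  simp [ancestor_zero, ancestor_ancestor, add_comm]

lemma ancestorSum_ne_top {D : ℝ} (hD : 0 ≤ D) {c : DyadicIndex n → ℝ≥0∞}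
    (hc : ∑' R, c R * pow2 (R.1 * D) ≠ ∞) (R : DyadicIndex n) : ancestorSum c R ≠ ∞ := by
  have h1 : ancestorSum c R * pow2 (R.1 * D) ≤ ∑' R, c R * pow2 (R.1 * D) := by
    rw [ancestorSum, ← ENNReal.tsum_mul_right]
    refine le_trans (ENNReal.tsum_le_tsum fun i => ?_)
      (ENNReal.tsum_comp_le_tsum_of_injective (ancestor_injective R)
        fun R => c R * pow2 (R.1 * D))
    refine mul_le_mul_right (pow2_mono ?_) _
    simp only [ancestor]
    push_cast
    have : (0 : ℝ) ≤ i := by positivity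
    nlinarith
  intro h
  rw [h, ENNReal.top_mul (pow2_ne_zero _)] at h1
  exact hc (top_le_iff.1 h1)

/-- Above any dyadic cube whose ancestor sum exceeds `t > 0` there is one at which the level `t`
is crossed. -/
lemma exists_ancestor_crossing {c : DyadicIndex n → ℝ≥0∞} {R : DyadicIndex n}
    (hR : ancestorSum c R ≠ ∞) {t : ℝ≥0∞} (ht : 0 < t) (h : t < ancestorSum c R) :
    ∃ i, ancestorSum c (ancestor 1 (ancestor i R)) ≤ t ∧ t < ancestorSum c (ancestor i R) := by
  have hex : ∃ j, ancestorSum c (ancestor j R) ≤ t := by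
    have := ENNReal.tendsto_sum_nat_add (fun i => c (ancestor i R)) hR
    obtain ⟨j, hj⟩ := (this.eventually_lt_const ht).exists
    refine ⟨j, le_of_lt ?_⟩
    simpa [ancestorSum, ancestor_ancestor, add_comm] using hj
  classical
  have hspec := Nat.find_spec hex
  have hpos : Nat.find hex ≠ 0 := by
    intro h0
    rw [h0, ancestor_zero] at hspec
    exact absurd h (not_lt.2 hspec)
  obtain ⟨j, hj⟩ := Nat.exists_eq_succ_of_ne_zero hpos
  refine ⟨j, ?_, not_le.1 (Nat.find_min hex (by omega))⟩
  rw [ancestor_ancestor]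
  rw [hj] at hspec
  exact hspec

lemma hContent_le_tsum_of_dyadic [NeZero n] {D : ℝ} (hD : 0 < D)
    {E : Set (EuclideanSpace ℝ (Fin n))} (F : Set (DyadicIndex n))
    (hE : ∀ x ∈ E, ∃ k, ∃ e ∈ neighbors n, (k, dyadicPos k x + e) ∈ F) :
    hContent n D E ≤
      ∑' R, F.indicator (fun R => (2 * n + 1 : ℝ≥0∞) ^ D * pow2 (R.1 * D)) R := by
  classical
  obtain ⟨hden⟩ := nonempty_denumerable (DyadicIndex n)
  let φ : ℕ ≃ DyadicIndex n := (Denumerable.eqv (DyadicIndex n)).symm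
  let r : DyadicIndex n → ℝ≥0 := fun R => if R ∈ F then (2 * n + 1) * 2 ^ R.1 else 0
  have hr : ∀ R, (r R : ℝ≥0∞) ^ D =
      F.indicator (fun R => (2 * n + 1 : ℝ≥0∞) ^ D * pow2 (R.1 * D)) R := by
    intro R
    by_cases hR : R ∈ F
    · have h2 : ((2 ^ R.1 : ℝ≥0) : ℝ≥0∞) = pow2 R.1 := by
        rw [pow2_intCast, ENNReal.ofReal, Real.toNNReal_zpow (by norm_num)]
        simp
      simp only [r, if_pos hR, indicator_of_mem hR, ENNReal.coe_mul, h2]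
      rw [ENNReal.mul_rpow_of_nonneg _ _ hD.le, pow2_rpow]
      push_cast
      rfl
    · simp [r, hR, hD]
  have hcov : E ⊆ ⋃ i, ball (dyadicCorner (φ i)) (r (φ i)) := by
    intro x hx
    obtain ⟨k, e, he, hF⟩ := hE x hx
    refine mem_iUnion.2 ⟨φ.symm (k, dyadicPos k x + e), ?_⟩
    rw [Equiv.apply_symm_apply]
    simp only [r, if_pos hF]
    push_cast
    exact mem_ball_dyadicCorner he k x
  calc hContent n D E ≤ ∑' i, (r (φ i) : ℝ≥0∞) ^ D :=
        iInf₂_le_of_le (fun i => dyadicCorner (φ i)) (fun i => r (φ i)) (iInf_le _ hcov)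
    _ = ∑' R, (r R : ℝ≥0∞) ^ D := φ.tsum_eq fun R => (r R : ℝ≥0∞) ^ D
    _ = _ := by simp_rw [hr]

/-- A function dominated by ancestor sums of the neighbouring cubes has Choquet integral
controlled by the total weight. -/
theorem echoquet_le_tsum [NeZero n] {D : ℝ} (hD : 0 < D) (c : DyadicIndex n → ℝ≥0∞)
    (h : EuclideanSpace ℝ (Fin n) → ℝ≥0∞)
    (hh : ∀ x, h x ≤ ⨆ k : ℤ, ⨆ e ∈ neighbors n, ancestorSum c (k, dyadicPos k x + e)) :
    echoquet n D univ h ≤ (2 * n + 1 : ℝ≥0∞) ^ D * ∑' R, c R * pow2 (R.1 * D) := by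
  by_cases hc : ∑' R, c R * pow2 (R.1 * D) = ∞
  · rw [hc, ENNReal.mul_top]
    · exact le_top
    · simp [ENNReal.rpow_eq_zero_iff, hD.le]
  have hS := ancestorSum_ne_top hD.le hc
  let I : DyadicIndex n → Set ℝ := fun R =>
    {t | ancestorSum c (ancestor 1 R) ≤ ENNReal.ofReal t ∧ ENNReal.ofReal t < ancestorSum c R}
  have hI : ∀ R, MeasurableSet (I R) := fun R =>
    (measurableSet_Ico (a := ancestorSum c (ancestor 1 R)) (b := ancestorSum c R)).preimage
      ENNReal.measurable_ofReal
  have hvol : ∀ R, volume (I R ∩ Ioi 0) ≤ c R := by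
    intro R
    have hsub : I R ∩ Ioi 0 ⊆
        Ico (ancestorSum c (ancestor 1 R)).toReal (ancestorSum c R).toReal := by
      rintro t ⟨⟨h1, h2⟩, h3⟩
      rw [mem_Ioi] at h3
      exact ⟨ENNReal.toReal_le_of_le_ofReal h3.le h1,
        (ENNReal.ofReal_lt_iff_lt_toReal h3.le (hS R)).1 h2⟩
    refine (measure_mono hsub).trans ?_
    rw [Real.volume_Ico, ENNReal.ofReal_sub _ ENNReal.toReal_nonneg, ENNReal.ofReal_toReal (hS _),
      ENNReal.ofReal_toReal (hS _), tsub_le_iff_right, ancestorSum_eq_add c R]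
  calc echoquet n D univ h
      ≤ ∫⁻ t in Ioi (0 : ℝ), ∑' R, (I R).indicator
          (fun _ => (2 * n + 1 : ℝ≥0∞) ^ D * pow2 (R.1 * D)) t := by
        refine setLIntegral_mono' measurableSet_Ioi fun t ht => ?_
        refine (hContent_le_tsum_of_dyadic hD {R | t ∈ I R} ?_).trans_eq ?_
        · rintro x ⟨-, hx⟩
          have h1 := hx.trans_le (hh x)
          simp only [lt_iSup_iff] at h1
          obtain ⟨k, e, he, h1⟩ := h1
          obtain ⟨i, hi⟩ := exists_ancestor_crossing (hS _) (ENNReal.ofReal_pos.2 ht) h1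
          obtain ⟨e', he', hee⟩ := exists_neighbor_ancestor he k i x
          exact ⟨k + i, e', he', by rw [← hee]; exact hi⟩
        · rfl
    _ = ∑' R, ∫⁻ t in Ioi (0 : ℝ), (I R).indicator
          (fun _ => (2 * n + 1 : ℝ≥0∞) ^ D * pow2 (R.1 * D)) t :=
        lintegral_tsum fun R => (measurable_const.indicator (hI R)).aemeasurable
    _ ≤ ∑' R, (2 * n + 1 : ℝ≥0∞) ^ D * (c R * pow2 (R.1 * D)) := by
        refine ENNReal.tsum_le_tsum fun R => ?_
        rw [lintegral_indicator_const (hI R), Measure.restrict_apply (hI R), mul_assoc,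
          mul_comm (c R)]
        gcongr
        exact hvol R
    _ = _ := ENNReal.tsum_mul_left

end

lemma hContent_mono {n : ℕ} {δ : ℝ} {E F : Set (EuclideanSpace ℝ (Fin n))} (h : E ⊆ F) :
    hContent n δ E ≤ hContent n δ F :=
  iInf_mono fun _ => iInf_mono fun _ => iInf_mono' fun hF => ⟨h.trans hF, le_rfl⟩

lemma tsum_pow2_mul_hContent_le {n : ℕ} (δ : ℝ) (h : EuclideanSpace ℝ (Fin n) → ℝ) :
    ∑' i : ℤ, pow2 i * hContent n δ {x ∈ univ | (2 : ℝ) ^ i < h x} ≤ 2 * choquet n δ univ h := by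
  let J : ℤ → Set ℝ := fun i => Ioc ((2 : ℝ) ^ (i - 1)) (2 ^ i)
  have hJ : Pairwise (Function.onFun Disjoint J) := by
    have : Monotone fun i : ℤ => (2 : ℝ) ^ (i - 1) := fun i j hij =>
      zpow_le_zpow_right₀ (by norm_num) (by omega)
    have h2 := this.pairwise_disjoint_on_Ioc_succ
    simpa [J] using h2
  calc ∑' i : ℤ, pow2 i * hContent n δ {x ∈ univ | (2 : ℝ) ^ i < h x}
      ≤ ∑' i : ℤ, 2 * ∫⁻ t in J i, hContent n δ {x ∈ univ | t < h x} := by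
        refine ENNReal.tsum_le_tsum fun i => ?_
        have hv : pow2 i = 2 * volume (J i) := by
          have h2 : (2 : ℝ) ^ i - 2 ^ (i - 1) = 2 ^ (i - 1) := by
            rw [zpow_sub_one₀ (by norm_num)]; ring
          rw [Real.volume_Ioc, h2, ← pow2_intCast,
            show (i : ℝ) = 1 + ((i - 1 : ℤ) : ℝ) by push_cast; ring, pow2_add]
          simp [pow2]
        rw [hv, mul_assoc]
        gcongr
        rw [mul_comm, ← setLIntegral_const]
        exact setLIntegral_mono' measurableSet_Ioc fun t ht =>
          hContent_mono fun x hx => ⟨hx.1, ht.2.trans_lt hx.2⟩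
    _ = 2 * ∫⁻ t in ⋃ i, J i, hContent n δ {x ∈ univ | t < h x} := by
        rw [ENNReal.tsum_mul_left, lintegral_iUnion (fun _ => measurableSet_Ioc) hJ]
    _ ≤ _ := by
        unfold choquet
        gcongr
        refine iUnion_subset fun i t ht => ?_
        exact lt_trans (by positivity) ht.1

lemma exists_pow2_scale {r : ℝ≥0} (hr : r ≠ 0) {δ : ℝ} (hδ : 0 ≤ δ) :
    ∃ k : ℤ, (r : ℝ) ≤ 2 ^ k ∧ pow2 (k * δ) ≤ pow2 δ * (r : ℝ≥0∞) ^ δ := by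
  obtain ⟨i, h1, h2⟩ := exists_pow2_lt_le (a := (r : ℝ≥0∞)) (by simpa using hr) (by simp)
  refine ⟨i + 1, ?_, ?_⟩
  · have : pow2 ((i : ℝ) + 1) = ENNReal.ofReal ((2 : ℝ) ^ (i + 1)) := by
      rw [← pow2_intCast]; push_cast; rfl
    rw [this, ← ENNReal.ofReal_coe_nnreal] at h2
    exact (ENNReal.ofReal_le_ofReal_iff (by positivity)).1 h2
  · calc pow2 (((i + 1 : ℤ) : ℝ) * δ) = pow2 δ * pow2 i ^ δ := by
          rw [pow2_rpow, ← pow2_add]; push_cast; ring_nf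
      _ ≤ _ := by gcongr

/-- The indices of the dyadic cubes obtained from a sequence of coverings by balls. -/
abbrev CoverIndex (n : ℕ) := ℤ × ℕ × neighbors n

/-- A function with finite Choquet integral is dominated by weights on dyadic cubes whose
total mass is comparable to the integral. -/
theorem exists_dyadic_majorant {n : ℕ} {δ : ℝ} (hδ : 0 ≤ δ)
    (h : EuclideanSpace ℝ (Fin n) → ℝ) {A : ℝ≥0∞} (hA : choquet n δ univ h < A) :
    ∃ (w : CoverIndex n → ℝ≥0∞) (P : CoverIndex n → DyadicIndex n),
      ∑' j, w j * pow2 ((P j).1 * δ) ≤ (neighbors n).card * (6 * pow2 δ) * A ∧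
      ∀ x, 0 < h x → ∃ j, x ∈ dyadicCube (P j) ∧ ENNReal.ofReal (h x) ≤ w j := by
  classical
  set A₀ := choquet n δ univ h
  let H : ℤ → ℝ≥0∞ := fun i => hContent n δ {x ∈ univ | (2 : ℝ) ^ i < h x}
  have hsum : ∑' i : ℤ, pow2 i * H i ≤ 2 * A₀ := tsum_pow2_mul_hContent_le δ h
  have hHtop : ∀ i, H i ≠ ∞ := by
    intro i hi
    have h1 := (ENNReal.le_tsum (f := fun i : ℤ => pow2 i * H i) i).trans hsum
    rw [hi, ENNReal.mul_top (pow2_ne_zero _)] at h1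
    exact (ENNReal.mul_lt_top (by simp) (hA.trans_le le_top)).ne (top_le_iff.1 h1)
  obtain ⟨ε, hε0, hε⟩ := ENNReal.exists_pos_sum_of_countable' (hA.bot_lt).ne' ℤ
  have hex : ∀ i : ℤ, ∃ (x : ℕ → EuclideanSpace ℝ (Fin n)) (r : ℕ → ℝ≥0),
      {x ∈ univ | (2 : ℝ) ^ i < h x} ⊆ ⋃ l, ball (x l) (r l) ∧
      ∑' l, (r l : ℝ≥0∞) ^ δ < H i + pow2 (-i) * ε i := by
    intro i
    have hlt : H i < H i + pow2 (-i) * ε i :=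
      ENNReal.lt_add_right (hHtop i) (mul_ne_zero (pow2_ne_zero _) (hε0 i).ne')
    obtain ⟨x, hx⟩ := iInf_lt_iff.1 hlt
    obtain ⟨r, hr⟩ := iInf_lt_iff.1 hx
    obtain ⟨hc, hs⟩ := iInf_lt_iff.1 hr
    exact ⟨x, r, hc, hs⟩
  choose x r hc hs using hex
  have hsc : ∀ ρ : ℝ≥0, ∃ k : ℤ, ρ ≠ 0 →
      (ρ : ℝ) ≤ 2 ^ k ∧ pow2 (k * δ) ≤ pow2 δ * (ρ : ℝ≥0∞) ^ δ := by
    intro ρ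
    by_cases hρ : ρ = 0
    · exact ⟨0, fun h => absurd hρ h⟩
    · obtain ⟨k, hk⟩ := exists_pow2_scale hρ hδ
      exact ⟨k, fun _ => hk⟩
  choose K hK using hsc
  refine ⟨fun j => if r j.1 j.2.1 = 0 then 0 else pow2 (j.1 + 1),
    fun j => (K (r j.1 j.2.1), dyadicPos (K (r j.1 j.2.1)) (x j.1 j.2.1) + j.2.2.1), ?_, ?_⟩
  · calc _ ≤ ∑' j : CoverIndex n, pow2 (j.1 + 1) * (pow2 δ * (r j.1 j.2.1 : ℝ≥0∞) ^ δ) := by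
          refine ENNReal.tsum_le_tsum fun j => ?_
          dsimp only
          split_ifs with h0
          · simp
          · gcongr
            exact (hK _ h0).2
      _ = ∑' i : ℤ, ∑' l : ℕ, (neighbors n).card *
            (pow2 (i + 1) * (pow2 δ * (r i l : ℝ≥0∞) ^ δ)) := by
          rw [ENNReal.tsum_prod']
          refine tsum_congr fun i => ?_
          rw [ENNReal.tsum_prod']
          refine tsum_congr fun l => ?_
          rw [tsum_fintype]
          simp
      _ = (neighbors n).card * (2 * pow2 δ) *
            ∑' i : ℤ, pow2 i * ∑' l : ℕ, (r i l : ℝ≥0∞) ^ δ := by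
          simp_rw [ENNReal.tsum_mul_left]
          rw [← ENNReal.tsum_mul_left, ← ENNReal.tsum_mul_left]
          refine tsum_congr fun i => ?_
          rw [pow2_add, show pow2 1 = 2 by simp [pow2]]
          ring
      _ ≤ (neighbors n).card * (2 * pow2 δ) * (3 * A) := by
          gcongr
          calc ∑' i : ℤ, pow2 i * ∑' l : ℕ, (r i l : ℝ≥0∞) ^ δ
              ≤ ∑' i : ℤ, (pow2 i * H i + ε i) := by
                refine ENNReal.tsum_le_tsum fun i => ?_
                refine (mul_le_mul_right (hs i).le _).trans_eq ?_
                rw [mul_add, ← mul_assoc, ← pow2_add, add_neg_cancel, pow2_zero, one_mul]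
            _ = ∑' i : ℤ, pow2 i * H i + ∑' i, ε i := ENNReal.tsum_add
            _ ≤ 2 * A + A := by
                gcongr
                exact hsum.trans (by gcongr)
            _ = 3 * A := by ring
      _ = _ := by ring
  · intro y hy
    obtain ⟨i, h1, h2⟩ := exists_pow2_lt_le (ENNReal.ofReal_pos.2 hy).ne' ENNReal.ofReal_ne_top
    rw [pow2_intCast] at h1
    have h1' := (ENNReal.ofReal_lt_ofReal_iff hy).1 h1
    obtain ⟨l, hl⟩ := mem_iUnion.1 (hc i ⟨mem_univ y, h1'⟩)
    have hr0 : r i l ≠ 0 := by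
      intro h0
      simp [h0] at hl
    rw [mem_ball'] at hl
    obtain ⟨e, he, hey⟩ := exists_neighbor_of_dist_lt (hl.trans_le (hK _ hr0).1)
    refine ⟨(i, l, ⟨e, he⟩), hey, ?_⟩
    simpa [hr0] using h2

lemma ENNReal.tsum_rpow_le {ι : Type*} (a : ι → ℝ≥0∞) {r : ℝ} (h0 : 0 < r) (h1 : r ≤ 1) :
    (∑' j, a j) ^ r ≤ ∑' j, a j ^ r := by
  classical
  rw [← ENNReal.le_rpow_inv_iff h0, ENNReal.tsum_eq_iSup_sum]
  refine iSup_le fun s => ?_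
  rw [ENNReal.le_rpow_inv_iff h0]
  refine le_trans ?_ (ENNReal.sum_le_tsum s)
  induction s using Finset.induction_on with
  | empty => simp [h0]
  | insert j s hj ih =>
    rw [Finset.sum_insert hj, Finset.sum_insert hj]
    exact (ENNReal.rpow_add_le_add_rpow _ _ h0.le h1).trans (by gcongr)

/-- The average of a function over a dyadic cube. -/
noncomputable def dyadicAvg {n : ℕ} (g : EuclideanSpace ℝ (Fin n) → ℝ≥0∞)
    (R : DyadicIndex n) : ℝ≥0∞ :=
  pow2 (-(R.1 * n)) * ∫⁻ y in dyadicCube R, g y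

/-- The proportion of the cube `R` that is occupied by the cube `P`. -/
noncomputable def overlap {n : ℕ} (P R : DyadicIndex n) : ℝ≥0∞ :=
  pow2 (-(R.1 * n)) * volume (dyadicCube P ∩ dyadicCube R)

section
variable {n : ℕ}

lemma overlap_cases {P R : DyadicIndex n} (h : overlap P R ≠ 0) :
    (∃ i : ℕ, ancestor i P = R ∧ overlap P R ≤ pow2 (-(i * n))) ∨
      ∃ i : ℕ, ancestor i R = P ∧ overlap P R ≤ 1 := by
  have hne : (dyadicCube P ∩ dyadicCube R).Nonempty := by
    rw [nonempty_iff_ne_empty]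
    intro he
    simp [overlap, he] at h
  obtain ⟨x, hxP, hxR⟩ := hne
  have hR : (R.1, dyadicPos R.1 x) = R := Prod.ext rfl hxR
  have hP : (P.1, dyadicPos P.1 x) = P := Prod.ext rfl hxP
  rcases le_total P.1 R.1 with hle | hle
  · obtain ⟨i, hi⟩ := Int.le.dest hle
    left
    refine ⟨i, by rw [ancestor_eq_of_mem hxP, hi, hR], ?_⟩
    refine (mul_le_mul_right (measure_mono inter_subset_left) _).trans_eq ?_
    rw [volume_dyadicCube, ← pow2_add, ← hi]
    push_cast
    ring_nf
  · obtain ⟨i, hi⟩ := Int.le.dest hle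
    right
    refine ⟨i, by rw [ancestor_eq_of_mem hxR, hi, hP], ?_⟩
    refine (mul_le_mul_right (measure_mono inter_subset_right) _).trans_eq ?_
    rw [volume_dyadicCube, ← pow2_add, neg_add_cancel, pow2_zero]

lemma dyadicAvg_rpow_le_dyadicAvg {g : EuclideanSpace ℝ (Fin n) → ℝ≥0∞} (hg : AEMeasurable g)
    {s : ℝ} (hs : 1 ≤ s) (R : DyadicIndex n) :
    dyadicAvg g R ^ s ≤ dyadicAvg (fun x => g x ^ s) R := by
  have hs0 : 0 < s := by linarith
  have h1 := eLpNorm'_le_eLpNorm'_mul_rpow_measure_univ (μ := volume.restrict (dyadicCube R))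
    one_pos hs hg.restrict.aestronglyMeasurable
  simp only [eLpNorm'_eq_lintegral_enorm, enorm_eq_self, ENNReal.rpow_one, ne_eq, one_ne_zero,
    not_false_eq_true, div_self, Measure.restrict_apply_univ, volume_dyadicCube] at h1
  unfold dyadicAvg
  calc (pow2 (-(R.1 * n)) * ∫⁻ y in dyadicCube R, g y) ^ s
      ≤ (pow2 (-(R.1 * n)) * ((∫⁻ y in dyadicCube R, g y ^ s) ^ (1 / s) *
          pow2 (R.1 * n) ^ (1 - 1 / s))) ^ s := by gcongr
    _ = pow2 (-(R.1 * n) * s) * pow2 (R.1 * n * ((1 - 1 / s) * s)) *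
          ∫⁻ y in dyadicCube R, g y ^ s := by
        rw [ENNReal.mul_rpow_of_nonneg _ _ hs0.le, ENNReal.mul_rpow_of_nonneg _ _ hs0.le,
          ← ENNReal.rpow_mul, ← ENNReal.rpow_mul, pow2_rpow, pow2_rpow,
          one_div_mul_cancel hs0.ne', ENNReal.rpow_one]
        ring
    _ = _ := by
        rw [← pow2_add]
        congr 2
        field_simp
        ring

variable {ι : Type*} {w : ι → ℝ≥0∞} {P : ι → DyadicIndex n}
  {g : EuclideanSpace ℝ (Fin n) → ℝ≥0∞} {p q s δ κ : ℝ}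

lemma rpow_le_tsum_indicator (hq : 0 < q) (hp : 0 < p)
    (hmaj : ∀ x, g x ≠ 0 → ∃ j, x ∈ dyadicCube (P j) ∧ g x ^ p ≤ w j) (hpqs : p = s * q)
    (x : EuclideanSpace ℝ (Fin n)) :
    g x ^ s ≤ ∑' j, (dyadicCube (P j)).indicator (fun _ => w j ^ q⁻¹) x := by
  by_cases hx : g x = 0
  · have : 0 < s := by
      by_contra! hs
      nlinarith
    simp [hx, this]
  obtain ⟨j, hj, hw⟩ := hmaj x hx
  refine le_trans ?_ (ENNReal.le_tsum j)
  rw [indicator_of_mem hj, ENNReal.le_rpow_inv_iff hq, ← ENNReal.rpow_mul, ← hpqs]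
  exact hw

variable [Countable ι]

lemma dyadicAvg_rpow_le_tsum (hg : AEMeasurable g) (hq : 0 < q) (hq1 : q ≤ 1) (hs : 1 ≤ s)
    (hpqs : p = s * q) (hmaj : ∀ x, g x ≠ 0 → ∃ j, x ∈ dyadicCube (P j) ∧ g x ^ p ≤ w j)
    (R : DyadicIndex n) : dyadicAvg g R ^ p ≤ ∑' j, w j * overlap (P j) R ^ q := by
  have hp : 0 < p := by rw [hpqs]; positivity
  have h1 : dyadicAvg (fun x => g x ^ s) R ≤ ∑' j, w j ^ q⁻¹ * overlap (P j) R := by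
    calc dyadicAvg (fun x => g x ^ s) R
        ≤ pow2 (-(R.1 * n)) * ∫⁻ y in dyadicCube R,
            ∑' j, (dyadicCube (P j)).indicator (fun _ => w j ^ q⁻¹) y := by
          unfold dyadicAvg
          gcongr with y
          exact rpow_le_tsum_indicator hq hp hmaj hpqs y
      _ = pow2 (-(R.1 * n)) *
            ∑' j, w j ^ q⁻¹ * volume (dyadicCube (P j) ∩ dyadicCube R) := by
          rw [lintegral_tsum fun j =>
            (measurable_const.indicator (measurableSet_dyadicCube _)).aemeasurable]
          congr 1
          refine tsum_congr fun j => ?_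
          rw [lintegral_indicator_const (measurableSet_dyadicCube _),
            Measure.restrict_apply (measurableSet_dyadicCube _)]
      _ = _ := by
          rw [← ENNReal.tsum_mul_left]
          refine tsum_congr fun j => ?_
          unfold overlap
          ring
  calc dyadicAvg g R ^ p = (dyadicAvg g R ^ s) ^ q := by rw [← ENNReal.rpow_mul, hpqs]
    _ ≤ (∑' j, w j ^ q⁻¹ * overlap (P j) R) ^ q := by
        gcongr
        exact (dyadicAvg_rpow_le_dyadicAvg hg hs R).trans h1
    _ ≤ ∑' j, (w j ^ q⁻¹ * overlap (P j) R) ^ q := ENNReal.tsum_rpow_le _ hq hq1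
    _ = _ := by
        refine tsum_congr fun j => ?_
        rw [ENNReal.mul_rpow_of_nonneg _ _ hq.le, ENNReal.rpow_inv_rpow hq.ne']

lemma dyadicAvg_rpow_le (hg : AEMeasurable g) (hq : 0 < q) (hq1 : q ≤ 1) (hs : 1 ≤ s)
    (hpqs : p = s * q) (hmaj : ∀ x, g x ≠ 0 → ∃ j, x ∈ dyadicCube (P j) ∧ g x ^ p ≤ w j)
    (hδ : 0 ≤ δ) (hδq : δ ≤ n * q) (R : DyadicIndex n) :
    dyadicAvg g R ^ p ≤ (∑' j, w j * pow2 ((P j).1 * δ)) * pow2 (-(R.1 * δ)) := by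
  refine (dyadicAvg_rpow_le_tsum hg hq hq1 hs hpqs hmaj R).trans ?_
  rw [← ENNReal.tsum_mul_right]
  refine ENNReal.tsum_le_tsum fun j => ?_
  rw [mul_assoc, ← pow2_add]
  gcongr
  by_cases h0 : overlap (P j) R = 0
  · simp [h0, hq]
  rcases overlap_cases h0 with ⟨i, hi, hle⟩ | ⟨i, hi, hle⟩
  · refine (ENNReal.rpow_le_rpow hle hq.le).trans ?_
    rw [pow2_rpow]
    refine pow2_mono ?_
    rw [← hi]
    simp only [ancestor]
    push_cast
    have : (0 : ℝ) ≤ i := by positivity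
    nlinarith
  · refine (ENNReal.rpow_le_one hle hq.le).trans ?_
    rw [← pow2_zero]
    refine pow2_mono ?_
    rw [← hi]
    simp only [ancestor]
    push_cast
    have : (0 : ℝ) ≤ i := by positivity
    nlinarith

/-- The case `δ < n q`: weights on ancestors of the cubes `P j` dominate the fractional averages. -/
theorem exists_weight_of_lt (hκ : 0 ≤ κ) (hg : AEMeasurable g) (hq : 0 < q) (hq1 : q ≤ 1)
    (hs : 1 ≤ s) (hpqs : p = s * q)
    (hmaj : ∀ x, g x ≠ 0 → ∃ j, x ∈ dyadicCube (P j) ∧ g x ^ p ≤ w j) :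
    ∃ c : DyadicIndex n → ℝ≥0∞,
      (∀ R, pow2 (R.1 * (κ * p)) * dyadicAvg g R ^ p ≤ ancestorSum c R) ∧
      ∑' R, c R * pow2 (R.1 * (δ - κ * p)) ≤
        (∑' i : ℕ, pow2 (-(i * (n * q - δ)))) * ∑' j, w j * pow2 ((P j).1 * δ) := by
  classical
  let b : ι → ℕ → ℝ≥0∞ := fun j i => w j * pow2 (((P j).1 + i) * (κ * p) - i * n * q)
  let c : DyadicIndex n → ℝ≥0∞ := fun R =>
    ∑' j, ∑' i : ℕ, if ancestor i (P j) = R then b j i else 0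
  refine ⟨c, fun R => ?_, ?_⟩
  · have hterm : ∀ j, pow2 (R.1 * (κ * p)) * (w j * overlap (P j) R ^ q) ≤
        ∑' l : ℕ, ∑' i : ℕ, if ancestor i (P j) = ancestor l R then b j i else 0 := by
      intro j
      by_cases h0 : overlap (P j) R = 0
      · simp [h0, hq]
      rcases overlap_cases h0 with ⟨i, hi, hle⟩ | ⟨l, hl, hle⟩
      · refine le_trans ?_ (ENNReal.le_tsum 0)
        refine le_trans ?_ (ENNReal.le_tsum i)
        rw [if_pos (by rw [hi, ancestor_zero])]
        calc _ ≤ pow2 (R.1 * (κ * p)) * (w j * pow2 (-(i * n)) ^ q) := by gcongr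
          _ = w j * (pow2 (R.1 * (κ * p)) * pow2 (-(i * n) * q)) := by rw [pow2_rpow]; ring
          _ = b j i := by
            rw [← pow2_add, ← hi]
            simp only [b, ancestor]
            push_cast
            ring_nf
      · refine le_trans ?_ (ENNReal.le_tsum l)
        refine le_trans ?_ (ENNReal.le_tsum 0)
        rw [if_pos (by rw [hl, ancestor_zero])]
        calc _ ≤ pow2 (R.1 * (κ * p)) * (w j * 1 ^ q) := by gcongr
          _ = w j * pow2 (R.1 * (κ * p)) := by rw [ENNReal.one_rpow, mul_one, mul_comm]
          _ ≤ b j 0 := by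
            refine mul_le_mul_right (pow2_mono ?_) _
            rw [← hl]
            simp only [ancestor]
            push_cast
            have h1 : (0 : ℝ) ≤ l := by positivity
            have h2 : 0 ≤ κ * p := mul_nonneg hκ (by rw [hpqs]; positivity)
            nlinarith
    calc _ ≤ pow2 (R.1 * (κ * p)) * ∑' j, w j * overlap (P j) R ^ q := by
          gcongr
          exact dyadicAvg_rpow_le_tsum hg hq hq1 hs hpqs hmaj R
      _ = ∑' j, pow2 (R.1 * (κ * p)) * (w j * overlap (P j) R ^ q) :=
          ENNReal.tsum_mul_left.symm
      _ ≤ _ := ENNReal.tsum_le_tsum hterm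
      _ = ancestorSum c R := ENNReal.tsum_comm
  · simp only [c]
    conv_lhs => simp only [← ENNReal.tsum_mul_right]
    rw [ENNReal.tsum_comm, ← ENNReal.tsum_mul_left]
    refine ENNReal.tsum_le_tsum fun j => ?_
    rw [ENNReal.tsum_comm, ← ENNReal.tsum_mul_right]
    refine ENNReal.tsum_le_tsum fun i => ?_
    rw [tsum_eq_single (ancestor i (P j)) (by
      intro R hR
      rw [if_neg hR.symm, zero_mul]), if_pos rfl]
    simp only [b]
    rw [mul_assoc, ← pow2_add, mul_left_comm (pow2 _), ← pow2_add]
    gcongr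
    refine pow2_mono (le_of_eq ?_)
    simp only [ancestor]
    push_cast
    ring
end

lemma tsum_pow2_le_of_growth {Z : Type*} {i : Z → ℤ} (hi : Function.Injective i) {θ : Z → ℝ}
    (hθ : ∀ z z', i z ≤ i z' → (i z' : ℝ) - i z ≤ θ z' - θ z) {β r : ℝ} (hr : 0 ≤ r)
    (hβ : ∀ z, θ z ≤ β) :
    ∑' z, pow2 (θ z * r) ≤ pow2 (β * r) * ∑' l : ℕ, pow2 (-(l * r)) := by
  rcases isEmpty_or_nonempty Z with hZ | ⟨⟨z₀⟩⟩
  · simp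
  obtain ⟨_, ⟨z₁, rfl⟩, hz₁⟩ := Int.exists_greatest_of_bdd (P := fun a => ∃ z, i z = a)
    ⟨i z₀ + ⌈β - θ z₀⌉₊, by
      rintro _ ⟨z, rfl⟩
      rcases le_total (i z) (i z₀) with h | h
      · omega
      · have h1 := hθ _ _ h
        have h2 := hβ z
        have h3 := Nat.le_ceil (β - θ z₀)
        have : (i z : ℝ) ≤ i z₀ + (⌈β - θ z₀⌉₊ : ℤ) := by push_cast; linarith
        exact_mod_cast this⟩ ⟨_, z₀, rfl⟩
  have hle : ∀ z, i z ≤ i z₁ := fun z => hz₁ _ ⟨z, rfl⟩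
  have hinj : Function.Injective fun z => (i z₁ - i z).toNat := by
    intro z z' h
    have h1 := hle z
    have h2 := hle z'
    dsimp only at h
    exact hi (by omega)
  rw [← ENNReal.tsum_mul_left]
  refine le_trans (ENNReal.tsum_le_tsum fun z => ?_)
    (ENNReal.tsum_comp_le_tsum_of_injective hinj fun l : ℕ => pow2 (β * r) * pow2 (-(l * r)))
  rw [← pow2_add]
  refine pow2_mono ?_
  have h1 : (((i z₁ - i z).toNat : ℕ) : ℝ) = i z₁ - i z := by
    have := Int.toNat_of_nonneg (sub_nonneg.2 (hle z))
    have h2 : (((i z₁ - i z).toNat : ℤ) : ℝ) = ((i z₁ - i z : ℤ) : ℝ) := by rw [this]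
    push_cast at h2
    exact h2
  rw [h1]
  have h2 := hθ _ _ (hle z)
  have h3 := hβ z₁
  nlinarith

/-- The dyadic cube `R` is maximal among those on which `u` exceeds `2 ^ i`. -/
def IsMaximalAt {n : ℕ} (u : DyadicIndex n → ℝ≥0∞) (i : ℤ) (R : DyadicIndex n) : Prop :=
  pow2 i < u R ∧ ∀ l : ℕ, 0 < l → u (ancestor l R) ≤ pow2 i

section
variable {n : ℕ} {u : DyadicIndex n → ℝ≥0∞}

lemma exists_ancestor_isMaximalAt {i : ℤ} {R : DyadicIndex n} (hR : pow2 i < u R)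
    (hu : ∃ L, ∀ l ≥ L, u (ancestor l R) ≤ pow2 i) : ∃ l, IsMaximalAt u i (ancestor l R) := by
  classical
  have hspec := Nat.find_spec hu
  have hpos : Nat.find hu ≠ 0 := by
    intro h0
    have := hspec 0 (by omega)
    rw [ancestor_zero] at this
    exact absurd hR (not_lt.2 this)
  obtain ⟨j, hj⟩ := Nat.exists_eq_succ_of_ne_zero hpos
  have hmin := Nat.find_min hu (m := j) (by omega)
  push Not at hmin
  obtain ⟨l, hl, hlt⟩ := hmin
  refine ⟨l, hlt, fun m hm => ?_⟩
  rw [ancestor_ancestor]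
  exact hspec _ (by omega)

lemma IsMaximalAt.level_le {x : EuclideanSpace ℝ (Fin n)} {i i' : ℤ} {R R' : DyadicIndex n}
    (h : IsMaximalAt u i R) (h' : IsMaximalAt u i' R') (hx : x ∈ dyadicCube R)
    (hx' : x ∈ dyadicCube R') (hi : i ≤ i') : R'.1 ≤ R.1 := by
  by_contra! hlt
  obtain ⟨l, hl⟩ := Int.le.dest hlt.le
  have hl0 : 0 < l := by omega
  have h1 := h.2 l hl0
  have h2 : ancestor l R = R' := by
    rw [ancestor_eq_of_mem hx, hl]
    exact Prod.ext rfl hx'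
  rw [h2] at h1
  exact absurd (h'.1.trans_le (h1.trans (pow2_mono (by exact_mod_cast hi)))) (lt_irrefl _)

lemma tsum_isMaximalAt_le {κ r : ℝ} (hκ : 0 ≤ κ) (hr : 0 ≤ r) (x : EuclideanSpace ℝ (Fin n))
    {a : ℝ≥0∞} (ha : a ≠ ∞) :
    ∑' z : DyadicIndex n × ℤ,
      {z : DyadicIndex n × ℤ | IsMaximalAt u z.2 z.1 ∧ x ∈ dyadicCube z.1 ∧
        pow2 (z.2 - z.1.1 * κ) / 2 < a}.indicator (fun z => pow2 ((z.2 - z.1.1 * κ) * r)) z ≤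
      (2 * a) ^ r * ∑' l : ℕ, pow2 (-(l * r)) := by
  by_cases h0 : a = 0
  · subst h0
    simp
  obtain ⟨β, hβ⟩ := exists_eq_pow2 (a := 2 * a) (by simp [h0]) (ENNReal.mul_ne_top (by simp) ha)
  rw [hβ, pow2_rpow, ← tsum_subtype]
  refine tsum_pow2_le_of_growth (i := fun z => z.1.2) ?_ ?_ hr ?_
  · rintro ⟨⟨R, i⟩, h1, h2, h3⟩ ⟨⟨R', i'⟩, h1', h2', h3'⟩ h
    dsimp only at h h1 h2 h1' h2'
    subst h
    have hk := le_antisymm (h1'.level_le h1 h2' h2 le_rfl) (h1.level_le h1' h2 h2' le_rfl)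
    have : R = R' := Prod.ext hk (by
      rw [← show dyadicPos R.1 x = R.2 from h2, ← show dyadicPos R'.1 x = R'.2 from h2', hk])
    subst this
    rfl
  · rintro ⟨⟨R, i⟩, h1, h2, h3⟩ ⟨⟨R', i'⟩, h1', h2', h3'⟩ h
    dsimp only at h h1 h2 h1' h2' ⊢
    have hk : (R'.1 : ℝ) ≤ R.1 := by exact_mod_cast h1.level_le h1' h2 h2' h
    nlinarith
  · rintro ⟨⟨R, i⟩, -, -, h⟩
    dsimp only at h ⊢
    by_contra! hlt
    have := pow2_lt_pow2 hlt
    rw [← hβ] at this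
    rw [ENNReal.div_lt_iff (by simp) (by simp), mul_comm a] at h
    exact lt_asymm this h

end

lemma pow2_mul_le_lintegral_of_lt_dyadicAvg {n : ℕ} {g : EuclideanSpace ℝ (Fin n) → ℝ≥0∞}
    {R : DyadicIndex n} {t : ℝ} (h : pow2 t < dyadicAvg g R) :
    pow2 (R.1 * n) * pow2 t ≤
      2 * ∫⁻ y in dyadicCube R, (Ioi (pow2 t / 2)).indicator id (g y) := by
  have h1 : pow2 (R.1 * n) * pow2 t ≤ ∫⁻ y in dyadicCube R, g y := by
    refine (mul_le_mul_right h.le _).trans_eq ?_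
    rw [dyadicAvg, ← mul_assoc, ← pow2_add, add_neg_cancel, pow2_zero, one_mul]
  have h2 : ∫⁻ y in dyadicCube R, g y ≤
      (∫⁻ y in dyadicCube R, (Ioi (pow2 t / 2)).indicator id (g y)) +
        pow2 (R.1 * n) * pow2 t / 2 := by
    calc _ ≤ ∫⁻ y in dyadicCube R, ((Ioi (pow2 t / 2)).indicator id (g y) + pow2 t / 2) := by
          refine lintegral_mono fun y => ?_
          by_cases hy : pow2 t / 2 < g y
          · rw [indicator_of_mem (by exact hy)]
            exact le_self_add
          · exact (not_lt.1 hy).trans le_add_self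
      _ = _ := by
          rw [lintegral_add_right _ measurable_const, setLIntegral_const, volume_dyadicCube,
            mul_comm (pow2 t / 2), mul_div_assoc]
  set X := pow2 (R.1 * n) * pow2 t
  have hX : X ≠ ∞ := ENNReal.mul_ne_top (pow2_ne_top _) (pow2_ne_top _)
  have h3 : X / 2 + X / 2 ≤
      (∫⁻ y in dyadicCube R, (Ioi (pow2 t / 2)).indicator id (g y)) + X / 2 := by
    rw [ENNReal.add_halves]
    exact h1.trans h2
  have h4 := ENNReal.le_of_add_le_add_right (ENNReal.div_ne_top hX (by simp)) h3
  calc X = 2 * (X / 2) := (ENNReal.mul_div_cancel two_ne_zero ENNReal.ofNat_ne_top).symm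
    _ ≤ _ := by gcongr

/-- The case `δ = n`: weights on the cubes that are maximal at the dyadic levels dominate the
fractional averages. -/
theorem exists_weight_of_one_lt {n : ℕ} {ι : Type*} [Countable ι] {w : ι → ℝ≥0∞}
    {P : ι → DyadicIndex n} {g : EuclideanSpace ℝ (Fin n) → ℝ≥0∞} {p κ : ℝ}
    (hκ : 0 ≤ κ) (hp : 1 < p) (hκp : κ * p < n) (hg : AEMeasurable g) (hgt : ∀ x, g x ≠ ∞)
    (hmaj : ∀ x, g x ≠ 0 → ∃ j, x ∈ dyadicCube (P j) ∧ g x ^ p ≤ w j)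
    (hT : ∑' j, w j * pow2 ((P j).1 * n) ≠ ∞) :
    ∃ c : DyadicIndex n → ℝ≥0∞,
      (∀ R, pow2 (R.1 * (κ * p)) * dyadicAvg g R ^ p ≤ ancestorSum c R) ∧
      ∑' R, c R * pow2 (R.1 * (n - κ * p)) ≤
        (2 * pow2 p * (2 ^ (p - 1) * ∑' l : ℕ, pow2 (-(l * (p - 1))))) *
          ∑' j, w j * pow2 ((P j).1 * n) := by
  classical
  have hp0 : 0 < p := by linarith
  set T := ∑' j, w j * pow2 ((P j).1 * n)
  let u : DyadicIndex n → ℝ≥0∞ := fun R => pow2 (R.1 * κ) * dyadicAvg g R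
  have hup : ∀ R, u R ^ p = pow2 (R.1 * (κ * p)) * dyadicAvg g R ^ p := fun R => by
    simp only [u]
    rw [ENNReal.mul_rpow_of_nonneg _ _ hp0.le, pow2_rpow, mul_assoc]
  have hbound : ∀ R, u R ^ p ≤ pow2 (R.1 * (κ * p - n)) * T := by
    intro R
    rw [hup]
    refine (mul_le_mul_right (dyadicAvg_rpow_le (δ := n) hg one_pos le_rfl hp.le (by ring) hmaj
      (by positivity) (by simp) R) _).trans_eq ?_
    rw [mul_comm _ (pow2 _), ← mul_assoc, ← pow2_add]
    congr 2
    ring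
  obtain ⟨t, ht⟩ : ∃ t, T ≤ pow2 t := by
    by_cases h0 : T = 0
    · exact ⟨0, by simp [h0]⟩
    · obtain ⟨t, ht⟩ := exists_eq_pow2 h0 hT
      exact ⟨t, ht.le⟩
  have hdecay : ∀ (i : ℤ) R, ∃ L, ∀ l ≥ L, u (ancestor l R) ≤ pow2 i := by
    intro i R
    obtain ⟨L, hL⟩ := exists_nat_ge ((t - i * p) / (n - κ * p) - R.1)
    refine ⟨L, fun l hl => ?_⟩
    rw [← ENNReal.rpow_le_rpow_iff hp0]
    refine (hbound _).trans ((mul_le_mul_right ht _).trans ?_)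
    rw [pow2_rpow, ← pow2_add]
    refine pow2_mono ?_
    simp only [ancestor]
    push_cast
    have hl' : (L : ℝ) ≤ l := by exact_mod_cast hl
    have h1 : (t - i * p) / (n - κ * p) ≤ l + R.1 := by linarith
    rw [div_le_iff₀ (by linarith)] at h1
    nlinarith
  let c : DyadicIndex n → ℝ≥0∞ := fun R =>
    ∑' i : ℤ, if IsMaximalAt u i R then pow2 ((i + 1) * p) else 0
  refine ⟨c, fun R => ?_, ?_⟩
  · rw [← hup]
    by_cases h0 : u R = 0
    · simp [h0, hp0]
    have hut : u R ≠ ∞ := by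
      intro h
      have := hbound R
      rw [h, ENNReal.top_rpow_of_pos hp0] at this
      exact ENNReal.mul_ne_top (pow2_ne_top _) hT (top_le_iff.1 this)
    obtain ⟨i, h1, h2⟩ := exists_pow2_lt_le h0 hut
    obtain ⟨l, hl⟩ := exists_ancestor_isMaximalAt h1 (hdecay i R)
    refine le_trans ?_ (ENNReal.le_tsum l)
    refine le_trans ?_ (ENNReal.le_tsum i)
    rw [if_pos hl, ← pow2_rpow]
    gcongr
  · let Z : EuclideanSpace ℝ (Fin n) → Set (DyadicIndex n × ℤ) := fun x =>
      {z | IsMaximalAt u z.2 z.1 ∧ x ∈ dyadicCube z.1 ∧ pow2 (z.2 - z.1.1 * κ) / 2 < g x}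
    let F : DyadicIndex n × ℤ → EuclideanSpace ℝ (Fin n) → ℝ≥0∞ := fun z x =>
      (if IsMaximalAt u z.2 z.1 then 2 * pow2 p * pow2 ((z.2 - z.1.1 * κ) * (p - 1)) else 0) *
        (dyadicCube z.1).indicator
          (fun y => (Ioi (pow2 (z.2 - z.1.1 * κ) / 2)).indicator id (g y)) x
    have hF : ∀ z x, F z x = 2 * pow2 p * g x *
        (Z x).indicator (fun z => pow2 ((z.2 - z.1.1 * κ) * (p - 1))) z := by
      intro z x
      by_cases h1 : IsMaximalAt u z.2 z.1 <;> by_cases h2 : x ∈ dyadicCube z.1 <;>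
        by_cases h3 : pow2 (z.2 - z.1.1 * κ) / 2 < g x <;>
        simp [F, Z, indicator, h1, h2, h3]
      ring
    have hmeas : ∀ z, AEMeasurable (F z) := by
      intro z
      refine AEMeasurable.const_mul ?_ _
      exact ((measurable_id.indicator measurableSet_Ioi).comp_aemeasurable hg).indicator
        (measurableSet_dyadicCube _)
    have hterm : ∀ R (i : ℤ), (if IsMaximalAt u i R then pow2 ((i + 1) * p) else 0) *
        pow2 (R.1 * (n - κ * p)) ≤ ∫⁻ x, F (R, i) x := by
      intro R i
      by_cases hM : IsMaximalAt u i R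
      swap
      · simp [hM]
      have hlt : pow2 (i - R.1 * κ) < dyadicAvg g R := by
        have h1 := hM.1
        by_contra! h2
        have h3 : u R ≤ pow2 i := by
          refine (mul_le_mul_right h2 _).trans_eq ?_
          rw [← pow2_add]
          ring_nf
        exact absurd h1 (not_lt.2 h3)
      have h1 := pow2_mul_le_lintegral_of_lt_dyadicAvg hlt
      simp only [F, if_pos hM]
      rw [lintegral_const_mul' _ _ (by
        simp [ENNReal.mul_eq_top, pow2_ne_top]), lintegral_indicator (measurableSet_dyadicCube _)]
      calc pow2 ((i + 1) * p) * pow2 (R.1 * (n - κ * p))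
          = pow2 p * pow2 ((i - R.1 * κ) * (p - 1)) *
              (pow2 (R.1 * n) * pow2 (i - R.1 * κ)) := by
            simp only [← pow2_add]
            ring_nf
        _ ≤ pow2 p * pow2 ((i - R.1 * κ) * (p - 1)) *
              (2 * ∫⁻ y in dyadicCube R, (Ioi (pow2 (i - R.1 * κ) / 2)).indicator id (g y)) :=
            mul_le_mul_right h1 _
        _ = _ := by ring
    calc ∑' R, c R * pow2 (R.1 * (n - κ * p))
        ≤ ∑' R, ∑' i : ℤ, ∫⁻ x, F (R, i) x := by
          refine ENNReal.tsum_le_tsum fun R => ?_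
          simp only [c]
          rw [← ENNReal.tsum_mul_right]
          exact ENNReal.tsum_le_tsum fun i => hterm R i
      _ = ∑' z, ∫⁻ x, F z x := (ENNReal.tsum_prod' (f := fun z => ∫⁻ x, F z x)).symm
      _ = ∫⁻ x, ∑' z, F z x := (lintegral_tsum hmeas).symm
      _ ≤ ∫⁻ x, (2 * pow2 p * (2 ^ (p - 1) * ∑' l : ℕ, pow2 (-(l * (p - 1))))) *
            ∑' j, (dyadicCube (P j)).indicator (fun _ => w j) x := by
          refine lintegral_mono fun x => ?_
          have h1 := tsum_isMaximalAt_le (u := u) hκ (r := p - 1) (by linarith) x (hgt x)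
          have h2 := rpow_le_tsum_indicator (q := 1) (s := p) one_pos hp0 hmaj (by ring) x
          simp only [inv_one, ENNReal.rpow_one] at h2
          simp only [hF]
          rw [ENNReal.tsum_mul_left]
          calc _ ≤ 2 * pow2 p * g x * ((2 * g x) ^ (p - 1) * ∑' l : ℕ, pow2 (-(l * (p - 1)))) := by
                gcongr
            _ = (2 * pow2 p * (2 ^ (p - 1) * ∑' l : ℕ, pow2 (-(l * (p - 1))))) * g x ^ p := by
                have : g x ^ p = g x * g x ^ (p - 1) := by
                  by_cases h0 : g x = 0
                  · simp [h0, hp0]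
                  · nth_rw 2 [← ENNReal.rpow_one (g x)]
                    rw [← ENNReal.rpow_add _ _ h0 (hgt x)]
                    ring_nf
                rw [ENNReal.mul_rpow_of_nonneg _ _ (by linarith), this]
                ring
            _ ≤ _ := by gcongr
      _ ≤ _ := by
          rw [lintegral_const_mul'', lintegral_tsum fun j =>
            (measurable_const.indicator (measurableSet_dyadicCube _)).aemeasurable]
          · refine mul_le_mul_right (ENNReal.tsum_le_tsum fun j => ?_) _
            rw [lintegral_indicator_const (measurableSet_dyadicCube _), volume_dyadicCube]
          · exact (Measurable.tsum fun j =>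
              measurable_const.indicator (measurableSet_dyadicCube _)).aemeasurable

lemma lintegral_div_edist_rpow_le {n : ℕ} [NeZero n] {g : EuclideanSpace ℝ (Fin n) → ℝ≥0∞}
    (hg : AEMeasurable g) (x : EuclideanSpace ℝ (Fin n)) :
    ∫⁻ y, g y / edist x y ^ ((n : ℝ) - 1) ≤
      pow2 (n - 1) * ∑' k : ℤ, ∑ e ∈ neighbors n, pow2 k * dyadicAvg g (k, dyadicPos k x + e) := by
  have hn : (0 : ℝ) ≤ n - 1 := by
    have : (1 : ℝ) ≤ n := by exact_mod_cast NeZero.one_le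
    linarith
  let F : ℤ → (Fin n → ℤ) → EuclideanSpace ℝ (Fin n) → ℝ≥0∞ := fun k e y =>
    pow2 k * (pow2 (-(k * n)) * (dyadicCube (k, dyadicPos k x + e)).indicator g y)
  have hF : ∀ k e, AEMeasurable (F k e) := fun k e =>
    ((hg.indicator (measurableSet_dyadicCube _)).const_mul _).const_mul _
  have hpt : ∀ y, y ≠ x → g y / edist x y ^ ((n : ℝ) - 1) ≤
      pow2 (n - 1) * ∑' k : ℤ, ∑ e ∈ neighbors n, F k e y := by
    intro y hy
    obtain ⟨m, hm1, hm2⟩ := exists_mem_Ico_zpow (dist_pos.2 hy.symm) (one_lt_two (α := ℝ))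
    obtain ⟨e, he, hey⟩ := exists_neighbor_of_dist_lt hm2
    have hd : pow2 m ≤ edist x y := by
      rw [pow2_intCast, edist_dist]
      exact ENNReal.ofReal_le_ofReal hm1
    calc g y / edist x y ^ ((n : ℝ) - 1) ≤ g y / pow2 m ^ ((n : ℝ) - 1) := by gcongr
      _ = pow2 (n - 1) * F (m + 1) e y := by
          simp only [F]
          rw [indicator_of_mem hey, ← mul_assoc, ← mul_assoc, ← pow2_add, ← pow2_add,
            pow2_rpow, div_eq_mul_inv, mul_comm]
          congr 1
          rw [pow2, ← ENNReal.rpow_neg, pow2]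
          congr 1
          push_cast
          ring
      _ ≤ _ := by
          refine mul_le_mul_right (le_trans ?_ (ENNReal.le_tsum (m + 1))) _
          exact Finset.single_le_sum (f := fun e => F (m + 1) e y) (fun _ _ => zero_le) he
  calc ∫⁻ y, g y / edist x y ^ ((n : ℝ) - 1)
      ≤ ∫⁻ y, pow2 (n - 1) * ∑' k : ℤ, ∑ e ∈ neighbors n, F k e y := by
        refine lintegral_mono_ae ?_
        have : ∀ᵐ y ∂(volume : Measure (EuclideanSpace ℝ (Fin n))), y ≠ x := by
          simp [ae_iff]
        filter_upwards [this] with y hy using hpt y hy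
    _ = _ := by
        rw [lintegral_const_mul' _ _ (pow2_ne_top _), lintegral_tsum fun k =>
          Finset.aemeasurable_fun_sum _ fun e _ => hF k e]
        congr 2 with k
        rw [lintegral_finsetSum' _ fun e _ => hF k e]
        refine Finset.sum_congr rfl fun e _ => ?_
        rw [lintegral_const_mul' _ _ (pow2_ne_top _), lintegral_const_mul' _ _ (pow2_ne_top _),
          lintegral_indicator (measurableSet_dyadicCube _)]
        rfl

/-- The constant in Hedberg's summation argument. -/
noncomputable def hedbergConst (α β : ℝ) : ℝ≥0∞ :=
  pow2 β * ∑' i : ℕ, pow2 (-(i * β)) + ∑' i : ℕ, pow2 (-(i * α))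

lemma hedbergConst_ne_top {α β : ℝ} (hα : 0 < α) (hβ : 0 < β) : hedbergConst α β ≠ ∞ :=
  ENNReal.add_ne_top.2 ⟨ENNReal.mul_ne_top (pow2_ne_top _) (tsum_pow2_nat_ne_top hβ),
    tsum_pow2_nat_ne_top hα⟩

/-- Hedberg's summation: a two-sided geometric series is controlled by its crossing term. -/
lemma tsum_min_pow2_le {α β : ℝ} (hα : 0 < α) (hβ : 0 < β) {a b : ℝ≥0∞} (hb0 : b ≠ 0)
    (hbt : b ≠ ∞) :
    ∑' k : ℤ, min (a * pow2 (k * α)) (b * pow2 (-(k * β))) ≤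
      hedbergConst α β * (a ^ (β / (α + β)) * b ^ (α / (α + β))) := by
  have hαβ : 0 < α + β := by linarith
  by_cases ha0 : a = 0
  · simp [ha0]
  by_cases hat : a = ∞
  · have h1 : hedbergConst α β ≠ 0 := by
      intro h
      have h2 := (add_eq_zero.1 h).2
      rw [ENNReal.tsum_eq_zero] at h2
      exact pow2_ne_zero _ (h2 0)
    have h2 : b ^ (α / (α + β)) ≠ 0 := by simp [ENNReal.rpow_eq_zero_iff, hb0, hbt]
    rw [hat, ENNReal.top_rpow_of_pos (by positivity), ENNReal.top_mul h2, ENNReal.mul_top h1]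
    exact le_top
  obtain ⟨ν, rfl⟩ := exists_eq_pow2 ha0 hat
  obtain ⟨μ, rfl⟩ := exists_eq_pow2 hb0 hbt
  set t := (μ - ν) / (α + β) with ht
  have htm : t * (α + β) = μ - ν := div_mul_cancel₀ _ hαβ.ne'
  have h1 := Int.floor_le t
  have h2 := Int.lt_floor_add_one t
  have hX : pow2 ν ^ (β / (α + β)) * pow2 μ ^ (α / (α + β)) = pow2 (ν + t * α) := by
    rw [pow2_rpow, pow2_rpow, ← pow2_add]
    congr 1
    rw [ht]
    field_simp
    ring
  rw [hX, ← (Equiv.addRight ⌊t⌋).tsum_eq, tsum_of_nat_of_neg_add_one ENNReal.summable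
    ENNReal.summable, hedbergConst, add_mul, mul_assoc, ← ENNReal.tsum_mul_right,
    ← ENNReal.tsum_mul_right, ← ENNReal.tsum_mul_left]
  refine add_le_add (ENNReal.tsum_le_tsum fun i => ?_) (ENNReal.tsum_le_tsum fun i => ?_)
  · refine (min_le_right _ _).trans ?_
    simp only [← pow2_add]
    refine pow2_mono ?_
    simp only [Equiv.coe_addRight]
    push_cast
    nlinarith
  · refine (min_le_left _ _).trans ?_
    simp only [← pow2_add]
    refine pow2_mono ?_
    simp only [Equiv.coe_addRight]
    push_cast
    nlinarith

lemma lintegral_div_edist_rpow_le_of_weight {n : ℕ} [NeZero n]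
    {g : EuclideanSpace ℝ (Fin n) → ℝ≥0∞} (hg : AEMeasurable g) {δ κ p : ℝ} (hp : 0 < p)
    (hpδ : p < δ) (hκ1 : κ < 1) {T : ℝ≥0∞} (hT0 : T ≠ 0) (hT : T ≠ ∞)
    (hgT : ∀ R, dyadicAvg g R ^ p ≤ T * pow2 (-(R.1 * δ))) {c : DyadicIndex n → ℝ≥0∞}
    (hc : ∀ R, pow2 (R.1 * (κ * p)) * dyadicAvg g R ^ p ≤ ancestorSum c R)
    (x : EuclideanSpace ℝ (Fin n)) :
    (∫⁻ y, g y / edist x y ^ ((n : ℝ) - 1)) ^ (p * (δ - κ * p) / (δ - p)) ≤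
      (pow2 (n - 1) * ((neighbors n).card * hedbergConst (1 - κ) ((δ - p) / p))) ^
        (p * (δ - κ * p) / (δ - p)) * T ^ (p * (1 - κ) / (δ - p)) *
        ⨆ k : ℤ, ⨆ e ∈ neighbors n, ancestorSum c (k, dyadicPos k x + e) := by
  have hδp : 0 < δ - p := by linarith
  have hκp : 0 < δ - κ * p := by nlinarith
  set S := ⨆ k : ℤ, ⨆ e ∈ neighbors n, ancestorSum c (k, dyadicPos k x + e)
  set H := hedbergConst (1 - κ) ((δ - p) / p)
  have hq : 0 < p * (δ - κ * p) / (δ - p) := by positivity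
  have hsum : ∑' k : ℤ, ∑ e ∈ neighbors n, pow2 k * dyadicAvg g (k, dyadicPos k x + e) ≤
      (neighbors n).card * (H * ((S ^ (1 / p)) ^ ((δ - p) / (δ - κ * p)) *
        (T ^ (1 / p)) ^ (p * (1 - κ) / (δ - κ * p)))) := by
    have h := tsum_min_pow2_le (α := 1 - κ) (β := (δ - p) / p) (by linarith) (by positivity)
      (a := S ^ (1 / p)) (b := T ^ (1 / p)) (by simp [ENNReal.rpow_eq_zero_iff, hT0, hT])
      (ENNReal.rpow_ne_top_of_nonneg (by positivity) hT)
    have e0 : 1 - κ + (δ - p) / p = (δ - κ * p) / p := by field_simp; ring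
    have e1 : (δ - p) / p / (1 - κ + (δ - p) / p) = (δ - p) / (δ - κ * p) := by
      rw [e0]; field_simp
    have e2 : (1 - κ) / (1 - κ + (δ - p) / p) = p * (1 - κ) / (δ - κ * p) := by
      rw [e0]; field_simp
    rw [e1, e2] at h
    refine le_trans ?_ (mul_le_mul_right h _)
    rw [← ENNReal.tsum_mul_left]
    refine ENNReal.tsum_le_tsum fun k => ?_
    rw [← nsmul_eq_mul]
    refine Finset.sum_le_card_nsmul _ _ _ fun e he => le_min ?_ ?_
    · have h1 : ancestorSum c (k, dyadicPos k x + e) ≤ S :=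
        le_iSup_of_le k (le_iSup₂_of_le e he le_rfl)
      rw [← ENNReal.rpow_le_rpow_iff hp, ENNReal.mul_rpow_of_nonneg _ _ hp.le,
        ENNReal.mul_rpow_of_nonneg _ _ hp.le, ← ENNReal.rpow_mul, one_div_mul_cancel hp.ne',
        ENNReal.rpow_one, pow2_rpow, pow2_rpow]
      calc _ = pow2 (k * (1 - κ) * p) *
            (pow2 (k * (κ * p)) * dyadicAvg g (k, dyadicPos k x + e) ^ p) := by
            rw [← mul_assoc, ← pow2_add]
            congr 2
            ring
        _ ≤ pow2 (k * (1 - κ) * p) * S := mul_le_mul_right ((hc _).trans h1) _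
        _ = _ := mul_comm _ _
    · rw [← ENNReal.rpow_le_rpow_iff hp, ENNReal.mul_rpow_of_nonneg _ _ hp.le,
        ENNReal.mul_rpow_of_nonneg _ _ hp.le, ← ENNReal.rpow_mul, one_div_mul_cancel hp.ne',
        ENNReal.rpow_one, pow2_rpow, pow2_rpow]
      refine (mul_le_mul_right (hgT _) _).trans_eq ?_
      rw [mul_left_comm, ← pow2_add]
      congr 2
      field_simp
      ring
  calc _ ≤ (pow2 (n - 1) * ((neighbors n).card * (H * ((S ^ (1 / p)) ^ ((δ - p) / (δ - κ * p)) *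
        (T ^ (1 / p)) ^ (p * (1 - κ) / (δ - κ * p)))))) ^ (p * (δ - κ * p) / (δ - p)) :=
        ENNReal.rpow_le_rpow ((lintegral_div_edist_rpow_le hg x).trans
          (mul_le_mul_right hsum _)) hq.le
    _ = ((pow2 (n - 1) * ((neighbors n).card * H)) *
          (T ^ (1 / p)) ^ (p * (1 - κ) / (δ - κ * p)) *
          (S ^ (1 / p)) ^ ((δ - p) / (δ - κ * p))) ^ (p * (δ - κ * p) / (δ - p)) := by
        congr 1
        ring
    _ = _ := by
        rw [ENNReal.mul_rpow_of_nonneg _ _ hq.le, ENNReal.mul_rpow_of_nonneg _ _ hq.le]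
        simp only [← ENNReal.rpow_mul]
        have hκp' : δ - p * κ ≠ 0 := by rw [mul_comm p]; exact hκp.ne'
        have e1 : 1 / p * (p * (1 - κ) / (δ - κ * p)) * (p * (δ - κ * p) / (δ - p)) =
            p * (1 - κ) / (δ - p) := by field_simp
        have e2 : 1 / p * ((δ - p) / (δ - κ * p)) * (p * (δ - κ * p) / (δ - p)) = 1 := by
          field_simp
        rw [e1, e2, ENNReal.rpow_one]

lemma exists_weight {n : ℕ} [NeZero n] {δ κ p : ℝ} (hδ : 0 < δ) (hδn : δ ≤ n) (hκ0 : 0 ≤ κ)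
    (hκ1 : κ < 1) (hp1 : δ / n < p) (hp2 : p < δ) :
    ∃ C : ℝ≥0∞, C ≠ ∞ ∧ ∀ (g : EuclideanSpace ℝ (Fin n) → ℝ≥0∞) (w : CoverIndex n → ℝ≥0∞)
      (P : CoverIndex n → DyadicIndex n), AEMeasurable g → (∀ x, g x ≠ ∞) →
      (∀ x, g x ≠ 0 → ∃ j, x ∈ dyadicCube (P j) ∧ g x ^ p ≤ w j) →
      ∑' j, w j * pow2 ((P j).1 * δ) ≠ ∞ →
      (∀ R, dyadicAvg g R ^ p ≤ (∑' j, w j * pow2 ((P j).1 * δ)) * pow2 (-(R.1 * δ))) ∧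
      ∃ c : DyadicIndex n → ℝ≥0∞,
        (∀ R, pow2 (R.1 * (κ * p)) * dyadicAvg g R ^ p ≤ ancestorSum c R) ∧
        ∑' R, c R * pow2 (R.1 * (δ - κ * p)) ≤ C * ∑' j, w j * pow2 ((P j).1 * δ) := by
  have hn : (0 : ℝ) < n := by exact_mod_cast NeZero.pos n
  have hp : 0 < p := lt_trans (by positivity) hp1
  have hpn : δ < n * p := by
    rw [div_lt_iff₀ hn] at hp1
    linarith
  have hq : 0 < min p 1 := lt_min hp one_pos
  have hpqs : p = max p 1 * min p 1 := by rw [max_mul_min, mul_one]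
  have hδq : δ ≤ n * min p 1 := by
    rcases min_choice p 1 with h | h <;> rw [h] <;> linarith
  rcases hδn.lt_or_eq with hlt | rfl
  · have hlt' : δ < n * min p 1 := by
      rcases min_choice p 1 with h | h <;> rw [h] <;> linarith
    exact ⟨_, tsum_pow2_nat_ne_top (sub_pos.2 hlt'), fun g w P hg _ hmaj _ =>
      ⟨dyadicAvg_rpow_le hg hq (min_le_right _ _) (le_max_right _ _) hpqs hmaj hδ.le hδq,
        exists_weight_of_lt hκ0 hg hq (min_le_right _ _) (le_max_right _ _) hpqs hmaj⟩⟩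
  · have h1p : 1 < p := by rwa [div_self hn.ne'] at hp1
    refine ⟨_, ENNReal.mul_ne_top (ENNReal.mul_ne_top ENNReal.ofNat_ne_top (pow2_ne_top _))
      (ENNReal.mul_ne_top (ENNReal.rpow_ne_top_of_nonneg (by linarith) ENNReal.ofNat_ne_top)
        (tsum_pow2_nat_ne_top (sub_pos.2 h1p))), fun g w P hg hgt hmaj hT =>
      ⟨dyadicAvg_rpow_le hg hq (min_le_right _ _) (le_max_right _ _) hpqs hmaj hδ.le hδq,
        exists_weight_of_one_lt hκ0 h1p (by nlinarith) hg hgt hmaj hT⟩⟩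

lemma echoquet_rieszPot_le {n : ℕ} [NeZero n] {δ κ p : ℝ} (hδ : 0 < δ) (hδn : δ ≤ n)
    (hκ0 : 0 ≤ κ) (hκ1 : κ < 1) (hp1 : δ / n < p) (hp2 : p < δ) :
    ∃ K : ℝ≥0∞, K ≠ ∞ ∧ ∀ f : EuclideanSpace ℝ (Fin n) → ℝ, LocallyIntegrable f volume →
      ∀ A : ℝ≥0∞, (choquet n δ univ fun x => |f x| ^ p) < A → A ≠ ∞ →
        (echoquet n (δ - κ * p) univ fun x =>
            rieszPot n f x ^ (p * (δ - κ * p) / (δ - p))) ^ ((δ - p) / (p * (δ - κ * p)))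
          ≤ K * A ^ (1 / p) := by
  have hn : (0 : ℝ) < n := by exact_mod_cast NeZero.pos n
  have hp : 0 < p := lt_trans (by positivity) hp1
  have hδp : 0 < δ - p := by linarith
  have hκp : 0 < δ - κ * p := by nlinarith
  have hκp' : δ - p * κ ≠ 0 := by rw [mul_comm p]; exact hκp.ne'
  obtain ⟨C, hC, hweight⟩ := exists_weight hδ hδn hκ0 hκ1 hp1 hp2
  set r := (δ - p) / (p * (δ - κ * p)) with hr
  have hr0 : 0 < r := by positivity
  set M := (pow2 (n - 1) * ((neighbors n).card * hedbergConst (1 - κ) ((δ - p) / p))) ^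
    (p * (δ - κ * p) / (δ - p))
  have hMt : M ≠ ∞ := ENNReal.rpow_ne_top_of_nonneg (by positivity)
    (ENNReal.mul_ne_top (pow2_ne_top _) (ENNReal.mul_ne_top (ENNReal.natCast_ne_top _)
      (hedbergConst_ne_top (by linarith) (by positivity))))
  set N := (neighbors n).card * (6 * pow2 δ) with hN
  have hNt : N ≠ ∞ := ENNReal.mul_ne_top (ENNReal.natCast_ne_top _)
    (ENNReal.mul_ne_top ENNReal.ofNat_ne_top (pow2_ne_top _))
  have hN0 : N ≠ 0 := by
    have : (neighbors n).card ≠ 0 := Finset.card_ne_zero.2 ⟨0, by simp [mem_neighbors]⟩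
    simp [hN, this, pow2_ne_zero]
  refine ⟨((2 * n + 1 : ℝ≥0∞) ^ (δ - κ * p) * (M * C)) ^ r * N ^ (1 / p),
    ENNReal.mul_ne_top (ENNReal.rpow_ne_top_of_nonneg hr0.le (ENNReal.mul_ne_top
      (ENNReal.rpow_ne_top_of_nonneg hκp.le (by finiteness)) (ENNReal.mul_ne_top hMt hC)))
      (ENNReal.rpow_ne_top_of_nonneg (by positivity) hNt), fun f hf A hA hAt => ?_⟩
  obtain ⟨w, P, hwP, hmaj⟩ := exists_dyadic_majorant hδ.le _ hA
  let g : EuclideanSpace ℝ (Fin n) → ℝ≥0∞ := fun x => ENNReal.ofReal |f x|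
  have hg : AEMeasurable g := (hf.aestronglyMeasurable.aemeasurable.abs).ennreal_ofReal
  have hgmaj : ∀ x, g x ≠ 0 → ∃ j, x ∈ dyadicCube (P j) ∧ g x ^ p ≤ w j := by
    intro x hx
    have hx' : 0 < |f x| := by simpa [g] using hx
    simp only [g]
    rw [ENNReal.ofReal_rpow_of_nonneg hx'.le hp.le]
    exact hmaj x (Real.rpow_pos_of_pos hx' _)
  set T := N * A with hT
  have hT0 : T ≠ 0 := mul_ne_zero hN0 (pos_of_gt hA).ne'
  have hTt : T ≠ ∞ := ENNReal.mul_ne_top hNt hAt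
  obtain ⟨havg, c, hc, hcsum⟩ := hweight g w P hg (fun _ => ENNReal.ofReal_ne_top) hgmaj
    (ne_top_of_le_ne_top hTt hwP)
  set s := p * (1 - κ) / (δ - p) with hs
  have hx : ∀ x, rieszPot n f x ^ (p * (δ - κ * p) / (δ - p)) ≤
      ⨆ k : ℤ, ⨆ e ∈ neighbors n,
        ancestorSum (fun R => M * T ^ s * c R) (k, dyadicPos k x + e) := by
    intro x
    refine (lintegral_div_edist_rpow_le_of_weight hg hp hp2 hκ1 hT0 hTt
      (fun R => (havg R).trans (mul_le_mul_left hwP _)) hc x).trans_eq ?_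
    simp only [ENNReal.mul_iSup, ancestorSum, ENNReal.tsum_mul_left]
    rfl
  calc _ ≤ ((2 * n + 1 : ℝ≥0∞) ^ (δ - κ * p) *
        ∑' R, M * T ^ s * c R * pow2 (R.1 * (δ - κ * p))) ^ r :=
        ENNReal.rpow_le_rpow (echoquet_le_tsum hκp _ _ hx) hr0.le
    _ ≤ ((2 * n + 1 : ℝ≥0∞) ^ (δ - κ * p) * (M * T ^ s * (C * T))) ^ r := by
        simp only [mul_assoc (M * T ^ s), ENNReal.tsum_mul_left]
        gcongr
        exact hcsum.trans (mul_le_mul_right hwP _)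
    _ = (((2 * n + 1 : ℝ≥0∞) ^ (δ - κ * p) * (M * C)) * T ^ (s + 1)) ^ r := by
        rw [ENNReal.rpow_add _ _ hT0 hTt, ENNReal.rpow_one]
        congr 1
        ring
    _ = _ := by
        have h1 : (s + 1) * r = 1 / p := by
          rw [hs, hr]
          field_simp
          ring
        rw [ENNReal.mul_rpow_of_nonneg _ _ hr0.le, ← ENNReal.rpow_mul, h1, hT,
          ENNReal.mul_rpow_of_nonneg N A (by positivity), mul_assoc]

/-- Remark: boundedness of the Riesz potential of order `1` w.r.t. Hausdorff
contents. For `0 < δ ≤ n`, `0 ≤ κ < 1` and `δ/n < p < δ` there is `c = c(n, δ, κ, p)` such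
that for every `f ∈ L¹_loc(ℝⁿ)`,
`(∫_{ℝⁿ} (I₁f)^{p(δ-κp)/(δ-p)} dH^{δ-κp}_∞)^{(δ-p)/(p(δ-κp))} ≤ c (∫_{ℝⁿ} |f|^p dH^δ_∞)^{1/p}`. -/
theorem riesz_potential_bounded_choquet (n : ℕ) (hn : 2 ≤ n) (δ κ p : ℝ)
    (hδ0 : 0 < δ) (hδn : δ ≤ (n : ℝ)) (hκ0 : 0 ≤ κ) (hκ1 : κ < 1)
    (hp1 : δ / n < p) (hp2 : p < δ) :
    ∃ c : ℝ≥0, 0 < c ∧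
      ∀ f : EuclideanSpace ℝ (Fin n) → ℝ, LocallyIntegrable f volume →
        (echoquet n (δ - κ * p) Set.univ fun x =>
            rieszPot n f x ^ (p * (δ - κ * p) / (δ - p))) ^ ((δ - p) / (p * (δ - κ * p)))
          ≤ c * (choquet n δ Set.univ fun x => |f x| ^ p) ^ (1 / p) := by
  have : NeZero n := ⟨by omega⟩
  have hn0 : (0 : ℝ) < n := by exact_mod_cast NeZero.pos n
  have hp : 0 < p := lt_trans (by positivity) hp1
  obtain ⟨K, hK, hbound⟩ := echoquet_rieszPot_le hδ0 hδn hκ0 hκ1 hp1 hp2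
  refine ⟨K.toNNReal + 1, by positivity, fun f hf => ?_⟩
  set X := (echoquet n (δ - κ * p) Set.univ fun x =>
    rieszPot n f x ^ (p * (δ - κ * p) / (δ - p))) ^ ((δ - p) / (p * (δ - κ * p)))
  set A := choquet n δ Set.univ fun x => |f x| ^ p
  have hKc : K ≤ (K.toNNReal + 1 : ℝ≥0) := by
    rw [ENNReal.coe_add, ENNReal.coe_toNNReal hK]
    exact le_self_add
  set c : ℝ≥0 := K.toNNReal + 1
  have hc0 : (c : ℝ≥0∞) ≠ 0 := by
    rw [ENNReal.coe_ne_zero]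
    positivity
  rw [mul_comm, ← ENNReal.div_le_iff hc0 ENNReal.coe_ne_top, one_div, ENNReal.le_rpow_inv_iff hp]
  refine le_of_forall_gt_imp_ge_of_dense fun A' hA => ?_
  by_cases hAt : A' = ∞
  · exact hAt ▸ le_top
  · rw [← ENNReal.le_rpow_inv_iff hp, ENNReal.div_le_iff hc0 ENNReal.coe_ne_top, mul_comm,
      ← one_div]
    exact (hbound f hf A' hA hAt).trans (mul_le_mul_left hKc _)
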